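/- arXiv:1807.03896 — 2 statements merged into one kernel-verified Lean document; each statement's English description precedes it below -/
import Mathlib

section
/- Let 𝔤 = 𝒜₄,₇ be the 4-dimensional real Lie algebra with brackets [e₂,e₃] = e₁, [e₁,e₄] = 2e₁, [e₂,e₄] = e₂, [e₃,e₄] = e₂ + e₃. Then for every inner product g on 𝔤 and every alternating 2-form F on 𝔤 such that (g,F) is a solution of the Einstein–Maxwell equations, the metric g is Einstein. (In fact, every F that is closed and co-closed with respect to g satisfies [F∘F]₀ = 0.) -/
open scoped BigOperators

noncomputable section

/-- The underlying vector space `ℝ⁴` of the 4-dimensional Lie algebra. -/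
abbrev V4 : Type := Fin 4 → ℝ

/-- The standard basis `e₁, e₂, e₃, e₄` (0-indexed). -/
def ee (i : Fin 4) : V4 := Pi.single i 1

/-- `g` is an inner product: a positive-definite symmetric bilinear form. -/
structure IsInnerProduct (g : V4 → V4 → ℝ) : Prop where
  symm : ∀ x y, g x y = g y x
  add_left : ∀ x y z, g (x + y) z = g x z + g y z
  smul_left : ∀ (a : ℝ) (x y : V4), g (a • x) y = a * g x y
  pos : ∀ x : V4, x ≠ 0 → 0 < g x x

/-- `F` is an alternating bilinear 2-form. -/
structure IsAltForm (F : V4 → V4 → ℝ) : Prop where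
  skew : ∀ x y, F x y = - F y x
  add_left : ∀ x y z, F (x + y) z = F x z + F y z
  smul_left : ∀ (a : ℝ) (x y : V4), F (a • x) y = a * F x y

/-- Chevalley–Eilenberg differential of a 2-form with respect to the bracket `br`:
`dF(x,y,z) = −F([x,y],z) + F([x,z],y) − F([y,z],x)`. -/
def cdiff (br : V4 → V4 → V4) (F : V4 → V4 → ℝ) (x y z : V4) : ℝ :=
  - F (br x y) z + F (br x z) y - F (br y z) x

/-- A 2-form is closed if its Chevalley–Eilenberg differential vanishes. -/
def IsClosedForm (br : V4 → V4 → V4) (F : V4 → V4 → ℝ) : Prop :=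
  ∀ x y z, cdiff br F x y z = 0

/-- The Gram matrix of a bilinear form in the standard basis. -/
def gram (g : V4 → V4 → ℝ) : Matrix (Fin 4) (Fin 4) ℝ :=
  Matrix.of fun i j => g (ee i) (ee j)

/-- The inverse Gram matrix. -/
def ginv (g : V4 → V4 → ℝ) : Matrix (Fin 4) (Fin 4) ℝ := (gram g)⁻¹

/-- The inner product induced by `g` on 2-forms:
`⟨α,β⟩ = (1/2) Σ g^{ik} g^{jl} α_{ij} β_{kl}`. -/
def formInner (g : V4 → V4 → ℝ) (α β : V4 → V4 → ℝ) : ℝ :=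
  (1 / 2) * ∑ i, ∑ j, ∑ k, ∑ l,
    ginv g i k * ginv g j l * α (ee i) (ee j) * β (ee k) (ee l)

/-- The volume form of `g` for the orientation `e¹∧e²∧e³∧e⁴`. -/
def vol (g : V4 → V4 → ℝ) (x y z w : V4) : ℝ :=
  Real.sqrt (gram g).det * Matrix.det (Matrix.of fun i j => ![x, y, z, w] i j)

/-- The wedge product of two 2-forms, as a 4-form. -/
def wedge22 (α β : V4 → V4 → ℝ) (x y z w : V4) : ℝ :=
  α x y * β z w - α x z * β y w + α x w * β y z
    + α z w * β x y - α y w * β x z + α y z * β x w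

/-- `sF` is the Hodge star `⋆F` of `F` with respect to `g` and the orientation
`e¹∧e²∧e³∧e⁴`: it is the 2-form with `α ∧ sF = ⟨α,F⟩_g vol_g` for all 2-forms `α`. -/
def IsHodgeStar (g : V4 → V4 → ℝ) (F sF : V4 → V4 → ℝ) : Prop :=
  IsAltForm sF ∧
    ∀ α : V4 → V4 → ℝ, IsAltForm α → ∀ x y z w,
      wedge22 α sF x y z w = formInner g α F * vol g x y z w

/-- `F` is co-closed: `d(⋆F) = 0`. -/
def IsCoclosed (br : V4 → V4 → V4) (g F : V4 → V4 → ℝ) : Prop :=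
  ∃ sF, IsHodgeStar g F sF ∧ IsClosedForm br sF

/-- Koszul expression: `g(∇ₓy, z) = (1/2)(g([x,y],z) − g([y,z],x) + g([z,x],y))`. -/
def koszul (br : V4 → V4 → V4) (g : V4 → V4 → ℝ) (x y z : V4) : ℝ :=
  (1 / 2) * (g (br x y) z - g (br y z) x + g (br z x) y)

/-- The Levi-Civita product `∇ₓ y`, i.e. the unique vector with
`g(∇ₓy, z) = koszul x y z` for all `z` (computed via the inverse Gram matrix). -/
def LC (br : V4 → V4 → V4) (g : V4 → V4 → ℝ) (x y : V4) : V4 :=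
  fun m => ∑ k, koszul br g x y (ee k) * ginv g k m

/-- Curvature `R(x,y)z = ∇ₓ∇_y z − ∇_y∇ₓ z − ∇_{[x,y]} z`. -/
def curv (br : V4 → V4 → V4) (g : V4 → V4 → ℝ) (x y z : V4) : V4 :=
  LC br g x (LC br g y z) - LC br g y (LC br g x z) - LC br g (br x y) z

/-- Ricci tensor `Ric(x,y) = Σᵢ g(R(vᵢ,x)y, vᵢ)` for a `g`-orthonormal basis `(vᵢ)`,
i.e. the trace of the endomorphism `z ↦ R(z,x)y`. -/
def ricci (br : V4 → V4 → V4) (g : V4 → V4 → ℝ) (x y : V4) : ℝ :=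
  ∑ i, curv br g (ee i) x y i

/-- Scalar curvature: the `g`-trace of the Ricci tensor. -/
def scal (br : V4 → V4 → V4) (g : V4 → V4 → ℝ) : ℝ :=
  ∑ a, ∑ b, ginv g a b * ricci br g (ee a) (ee b)

/-- Trace-free Ricci tensor `Ric₀ = Ric − (s/4) g`. -/
def ricci0 (br : V4 → V4 → V4) (g : V4 → V4 → ℝ) (x y : V4) : ℝ :=
  ricci br g x y - (scal br g / 4) * g x y

/-- `g` is Einstein: `Ric₀ = 0`. -/
def IsEinstein (br : V4 → V4 → V4) (g : V4 → V4 → ℝ) : Prop :=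
  ∀ x y, ricci0 br g x y = 0

/-- The endomorphism `F̂` with `g(F̂x, y) = F(x,y)` (computed via the inverse Gram matrix). -/
def fhat (g F : V4 → V4 → ℝ) (x : V4) : V4 :=
  fun m => ∑ k, F x (ee k) * ginv g k m

/-- `[F∘F]₀(x,y) = g(F̂(F̂x), y) − (1/4) tr(F̂∘F̂) g(x,y)`. -/
def FF0 (g F : V4 → V4 → ℝ) (x y : V4) : ℝ :=
  g (fhat g F (fhat g F x)) y
    - (1 / 4) * (∑ i, fhat g F (fhat g F (ee i)) i) * g x y

/-- `(g, F)` is a solution of the Einstein--Maxwell equations: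
`dF = 0`, `d(⋆F) = 0`, and `Ric₀ = −[F∘F]₀`. -/
def IsEMSolution (br : V4 → V4 → V4) (g F : V4 → V4 → ℝ) : Prop :=
  IsClosedForm br F ∧ IsCoclosed br g F ∧ ∀ x y, ricci0 br g x y = - FF0 g F x y

/-- Nijenhuis tensor `N_J(x,y) = [Jx,Jy] − J[Jx,y] − J[x,Jy] − [x,y]`. -/
def nijenhuis (br : V4 → V4 → V4) (J : V4 →ₗ[ℝ] V4) (x y : V4) : V4 :=
  br (J x) (J y) - J (br (J x) y) - J (br x (J y)) - br x y

/-- The Lie algebra `𝒜₄,₇`: `[e₂,e₃] = e₁`, `[e₁,e₄] = 2e₁`, `[e₂,e₄] = e₂`, `[e₃,e₄] = e₂ + e₃`. -/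
def brA47 : V4 → V4 → V4 := fun x y =>
  ((x 1 * y 2 - x 2 * y 1) + 2 * (x 0 * y 3 - x 3 * y 0)) • ee 0
    + ((x 1 * y 3 - x 3 * y 1) + (x 2 * y 3 - x 3 * y 2)) • ee 1
    + (x 2 * y 3 - x 3 * y 2) • ee 2

open scoped Matrix

/-- The dual of an antisymmetric `4 × 4` matrix. -/
def skewDual (A : Matrix (Fin 4) (Fin 4) ℝ) : Matrix (Fin 4) (Fin 4) ℝ :=
  !![0, A 2 3, -A 1 3, A 1 2;
    -A 2 3, 0, A 0 3, -A 0 2;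
    A 1 3, -A 0 3, 0, A 0 1;
    -A 1 2, A 0 2, -A 0 1, 0]

/-- The Pfaffian of an antisymmetric `4 × 4` matrix. -/
def pfaffian4 (A : Matrix (Fin 4) (Fin 4) ℝ) : ℝ :=
  A 0 1 * A 2 3 - A 0 2 * A 1 3 + A 0 3 * A 1 2

/-- The antisymmetric matrix with the given entries above the diagonal. -/
def skewMatrix (a b c d e f : ℝ) : Matrix (Fin 4) (Fin 4) ℝ :=
  !![0, a, b, c; -a, 0, d, e; -b, -d, 0, f; -c, -e, -f, 0]

theorem eq_skewMatrix {A : Matrix (Fin 4) (Fin 4) ℝ} (hA : ∀ i j, A i j = -A j i) :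
    A = skewMatrix (A 0 1) (A 0 2) (A 0 3) (A 1 2) (A 1 3) (A 2 3) := by
  have h (i) : A i i = 0 := by linarith [hA i i]
  ext i j
  fin_cases i <;> fin_cases j <;> simp [skewMatrix, h] <;> exact hA _ _

theorem mul_skewDual {A : Matrix (Fin 4) (Fin 4) ℝ} (hA : ∀ i j, A i j = -A j i) :
    A * skewDual A = -pfaffian4 A • (1 : Matrix (Fin 4) (Fin 4) ℝ) := by
  rw [eq_skewMatrix hA]
  ext i j
  fin_cases i <;> fin_cases j <;>
    simp [Matrix.mul_apply, Fin.sum_univ_four, skewMatrix, skewDual, pfaffian4] <;> ring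

theorem det_fin_four (G : Matrix (Fin 4) (Fin 4) ℝ) :
    G.det =
      G 0 0 * (G 1 1 * (G 2 2 * G 3 3 - G 2 3 * G 3 2) - G 1 2 * (G 2 1 * G 3 3 - G 2 3 * G 3 1)
        + G 1 3 * (G 2 1 * G 3 2 - G 2 2 * G 3 1))
      - G 0 1 * (G 1 0 * (G 2 2 * G 3 3 - G 2 3 * G 3 2) - G 1 2 * (G 2 0 * G 3 3 - G 2 3 * G 3 0)
        + G 1 3 * (G 2 0 * G 3 2 - G 2 2 * G 3 0))
      + G 0 2 * (G 1 0 * (G 2 1 * G 3 3 - G 2 3 * G 3 1) - G 1 1 * (G 2 0 * G 3 3 - G 2 3 * G 3 0)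
        + G 1 3 * (G 2 0 * G 3 1 - G 2 1 * G 3 0))
      - G 0 3 * (G 1 0 * (G 2 1 * G 3 2 - G 2 2 * G 3 1) - G 1 1 * (G 2 0 * G 3 2 - G 2 2 * G 3 0)
        + G 1 2 * (G 2 0 * G 3 1 - G 2 1 * G 3 0)) := by
  rw [Matrix.det_succ_row_zero]
  simp [Fin.sum_univ_four, Matrix.det_fin_three, Fin.succAbove]
  ring

set_option maxHeartbeats 2000000 in
theorem pfaffian4_conj {A : Matrix (Fin 4) (Fin 4) ℝ} (hA : ∀ i j, A i j = -A j i)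
    (G : Matrix (Fin 4) (Fin 4) ℝ) :
    pfaffian4 (G * A * Gᵀ) = G.det * pfaffian4 A := by
  rw [eq_skewMatrix hA, det_fin_four]
  simp [Matrix.mul_apply, Fin.sum_univ_four, skewMatrix, pfaffian4]
  ring

set_option maxHeartbeats 4000000 in
theorem skewDual_conj {A : Matrix (Fin 4) (Fin 4) ℝ} (hA : ∀ i j, A i j = -A j i)
    (G : Matrix (Fin 4) (Fin 4) ℝ) :
    Gᵀ * skewDual (G * A * Gᵀ) * G = G.det • skewDual A := by
  rw [eq_skewMatrix hA, det_fin_four]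
  ext i j
  fin_cases i <;> fin_cases j <;>
    simp [Matrix.mul_apply, Fin.sum_univ_four, skewMatrix, skewDual] <;> ring

theorem ee_apply (i j : Fin 4) : ee i j = if j = i then 1 else 0 := by
  simp [ee, Pi.single_apply]

theorem apply_eq_sum {B : V4 → V4 → ℝ} (hadd : ∀ x y z, B (x + y) z = B x z + B y z)
    (hsmul : ∀ (a : ℝ) (x y : V4), B (a • x) y = a * B x y) (x y : V4) :
    B x y = ∑ i, x i * B (ee i) y := by
  have h : x = x 0 • ee 0 + x 1 • ee 1 + x 2 • ee 2 + x 3 • ee 3 := by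
    ext j; fin_cases j <;> simp [ee_apply]
  conv_lhs => rw [h]
  simp only [hadd, hsmul, Fin.sum_univ_four]

theorem IsAltForm.gram_skew {F : V4 → V4 → ℝ} (hF : IsAltForm F) (i j : Fin 4) :
    gram F i j = -gram F j i := hF.skew _ _

theorem IsInnerProduct.gram_transpose {g : V4 → V4 → ℝ} (hg : IsInnerProduct g) :
    (gram g)ᵀ = gram g := by
  ext i j; exact hg.symm _ _

theorem IsInnerProduct.gram_posDef {g : V4 → V4 → ℝ} (hg : IsInnerProduct g) :
    (gram g).PosDef := by
  refine Matrix.PosDef.of_dotProduct_mulVec_pos ?_ ?_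
  · ext i j; simpa [gram] using hg.symm _ _
  · intro x hx
    have h := hg.pos x hx
    rw [apply_eq_sum hg.add_left hg.smul_left] at h
    refine h.trans_eq ?_
    simp only [dotProduct, Matrix.mulVec, star_trivial, gram, Matrix.of_apply]
    refine Finset.sum_congr rfl fun i _ => ?_
    rw [hg.symm (ee i) x, apply_eq_sum hg.add_left hg.smul_left x]
    congr 1
    refine Finset.sum_congr rfl fun j _ => ?_
    rw [hg.symm (ee j), mul_comm]

/-- The closed 2-forms on `𝒜₄,₇` lie in the span of `2 e¹⁴ + e²³`, `e²⁴` and `e³⁴`. -/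
theorem IsClosedForm.gram_eq {F : V4 → V4 → ℝ} (hF : IsAltForm F)
    (hc : IsClosedForm brA47 F) :
    gram F 0 1 = 0 ∧ gram F 0 2 = 0 ∧ gram F 0 3 = 2 * gram F 1 2 := by
  have h0 : F 0 (ee 3) = 0 := by simpa using hF.smul_left 0 0 (ee 3)
  have h013 := hc (ee 0) (ee 1) (ee 3)
  have h023 := hc (ee 0) (ee 2) (ee 3)
  have h123 := hc (ee 1) (ee 2) (ee 3)
  simp [cdiff, brA47, hF.add_left, hF.smul_left, ee_apply] at h013 h023 h123
  simp only [gram, Matrix.of_apply]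
  have := hF.skew (ee 1) (ee 0)
  have := hF.skew (ee 2) (ee 0)
  have := hF.skew (ee 2) (ee 1)
  have := hF.skew (ee 1) (ee 1)
  refine ⟨?_, ?_, ?_⟩ <;> linarith

/-- The elementary 2-form `eᵖ ∧ e^q`. -/
def elemForm (p q : Fin 4) (x y : V4) : ℝ := x p * y q - x q * y p

theorem elemForm_isAltForm (p q : Fin 4) : IsAltForm (elemForm p q) where
  skew x y := by simp [elemForm]; ring
  add_left x y z := by simp [elemForm]; ring
  smul_left a x y := by simp [elemForm]; ring

/-- The components of `F` with both indices raised by `g`. -/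
def raised (g F : V4 → V4 → ℝ) : Matrix (Fin 4) (Fin 4) ℝ :=
  ginv g * gram F * (ginv g)ᵀ

theorem raised_skew (g : V4 → V4 → ℝ) {F : V4 → V4 → ℝ} (hF : IsAltForm F) (i j : Fin 4) :
    raised g F i j = -raised g F j i := by
  have h : (gram F)ᵀ = -gram F := by ext i j; exact hF.gram_skew _ _
  have : (raised g F)ᵀ = -raised g F := by
    simp [raised, Matrix.transpose_mul, h, Matrix.mul_assoc]
  exact congrFun (congrFun this j) i

theorem formInner_elemForm (g : V4 → V4 → ℝ) {F : V4 → V4 → ℝ} (hF : IsAltForm F)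
    (p q : Fin 4) : formInner g (elemForm p q) F = raised g F p q := by
  have key (a b : Fin 4) : raised g F a b =
      ∑ k, ∑ l, ginv g a k * ginv g b l * F (ee k) (ee l) := by
    simp only [raised, Matrix.mul_apply, Matrix.transpose_apply, gram, Matrix.of_apply,
      Finset.sum_mul]
    rw [Finset.sum_comm]
    exact Finset.sum_congr rfl fun k _ => Finset.sum_congr rfl fun l _ => by ring
  have h : formInner g (elemForm p q) F = 1 / 2 * (raised g F p q - raised g F q p) := by
    have (i j : Fin 4) : ∑ k, ∑ l, ginv g i k * ginv g j l * elemForm p q (ee i) (ee j)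
        * F (ee k) (ee l) = elemForm p q (ee i) (ee j) * raised g F i j := by
      simp only [key, Finset.mul_sum]
      exact Finset.sum_congr rfl fun k _ => Finset.sum_congr rfl fun l _ => by ring
    simp only [formInner, this]
    simp only [elemForm, ee_apply, sub_mul, Finset.sum_sub_distrib]
    simp
  rw [h, raised_skew g hF q p]
  ring

theorem vol_ee (g : V4 → V4 → ℝ) :
    vol g (ee 0) (ee 1) (ee 2) (ee 3) = √(gram g).det := by
  have : (Matrix.of fun i j => ![ee 0, ee 1, ee 2, ee 3] i j) = 1 := by
    ext i j; fin_cases i <;> fin_cases j <;> simp [ee_apply]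
  rw [vol, this, Matrix.det_one, mul_one]

/-- The dual condition to closedness satisfied by a co-closed 2-form on `𝒜₄,₇`. -/
theorem IsCoclosed.raised_eq {g F : V4 → V4 → ℝ} (hg : IsInnerProduct g) (hF : IsAltForm F)
    (hc : IsCoclosed brA47 g F) :
    raised g F 2 3 = 0 ∧ raised g F 1 3 = 0 ∧ raised g F 1 2 = 2 * raised g F 0 3 := by
  obtain ⟨sF, ⟨hsF, hstar⟩, hcl⟩ := hc
  obtain ⟨h01, h02, h03⟩ := hcl.gram_eq hsF
  have hs : 0 < √(gram g).det := Real.sqrt_pos.2 hg.gram_posDef.det_pos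
  have key (p q) := hstar _ (elemForm_isAltForm p q) (ee 0) (ee 1) (ee 2) (ee 3)
  simp only [formInner_elemForm g hF, vol_ee] at key
  have k23 := key 2 3
  have k13 := key 1 3
  have k12 := key 1 2
  have k03 := key 0 3
  simp [wedge22, elemForm, ee_apply] at k23 k13 k12 k03
  simp only [gram, Matrix.of_apply] at h01 h02 h03
  refine ⟨?_, ?_, ?_⟩ <;> apply mul_right_cancel₀ hs.ne'
  · linarith
  · linarith
  · linarith

theorem gram_eq_conj_raised {g : V4 → V4 → ℝ} (hg : IsInnerProduct g) (F : V4 → V4 → ℝ) :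
    gram g * raised g F * (gram g)ᵀ = gram F := by
  have hu : IsUnit (gram g).det := hg.gram_posDef.det_pos.ne'.isUnit
  have h1 : gram g * ginv g = 1 := Matrix.mul_nonsing_inv _ hu
  have h2 : (ginv g)ᵀ * (gram g)ᵀ = 1 := by rw [← Matrix.transpose_mul, h1, Matrix.transpose_one]
  calc gram g * raised g F * (gram g)ᵀ
      = (gram g * ginv g) * gram F * ((ginv g)ᵀ * (gram g)ᵀ) := by
        simp only [raised, Matrix.mul_assoc]
    _ = gram F := by rw [h1, h2, Matrix.one_mul, Matrix.mul_one]

/-- A closed and co-closed 2-form on `𝒜₄,₇` is self-dual or anti-self-dual. -/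
theorem exists_skewDual_gram_eq {g F : V4 → V4 → ℝ} (hg : IsInnerProduct g) (hF : IsAltForm F)
    (hcl : IsClosedForm brA47 F) (hco : IsCoclosed brA47 g F) :
    ∃ t : ℝ, t ≠ 0 ∧ skewDual (gram F) = t • raised g F := by
  obtain ⟨h01, h02, h03⟩ := hcl.gram_eq hF
  obtain ⟨m23, m13, m12⟩ := hco.raised_eq hg hF
  have hdet : 0 < (gram g).det := hg.gram_posDef.det_pos
  have hskew := raised_skew g hF
  have hpf := pfaffian4_conj hskew (gram g)
  have hdual := skewDual_conj hskew (gram g)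
  rw [gram_eq_conj_raised hg] at hpf hdual
  simp only [pfaffian4, h01, h02, h03, m23, m13, m12] at hpf
  obtain ⟨t, ht, hta⟩ : ∃ t : ℝ, t ^ 2 = (gram g).det ∧ gram F 1 2 = t * raised g F 0 3 := by
    have hs := Real.sq_sqrt hdet.le
    have : gram F 1 2 ^ 2 = (√(gram g).det * raised g F 0 3) ^ 2 := by
      rw [mul_pow, hs]; linarith
    rcases sq_eq_sq_iff_eq_or_eq_neg.1 this with h | h
    · exact ⟨_, hs, h⟩
    · exact ⟨-√(gram g).det, by rw [neg_sq, hs], by rw [h]; ring⟩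
  have ht0 : t ≠ 0 := by rintro rfl; simp at ht; linarith
  refine ⟨t, ht0, ?_⟩
  set H := skewDual (gram F) - t • raised g F with hH
  have hconj : gram g * H * gram g = -t • skewDual H := by
    have h1 : skewDual H = gram F - t • skewDual (raised g F) := by
      rw [hH, eq_skewMatrix hF.gram_skew, eq_skewMatrix hskew]
      ext i j
      fin_cases i <;> fin_cases j <;> simp [skewDual, skewMatrix] <;> ring
    have h2 := gram_eq_conj_raised hg F
    rw [hg.gram_transpose] at hdual h2
    rw [h1, hH, Matrix.mul_sub, Matrix.sub_mul, hdual, Matrix.mul_smul, Matrix.smul_mul, h2, ← ht]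
    module
  have hHeq : H = skewMatrix (H 0 1) (H 0 2) 0 0 0 0 := by
    rw [hH, eq_skewMatrix hskew, m23, m13, m12]
    ext i j
    fin_cases i <;> fin_cases j <;> simp [skewDual, skewMatrix, h01, h02, h03, hta] <;> ring
  have hcol : (H * gram g) *ᵥ ee 0 = 0 := by
    have hinj := Matrix.mulVec_injective_of_isUnit
      ((Matrix.isUnit_iff_isUnit_det _).2 hdet.ne'.isUnit)
    apply hinj
    rw [Matrix.mulVec_mulVec, ← Matrix.mul_assoc, hconj, hHeq]
    ext i
    fin_cases i <;> simp [skewDual, skewMatrix, ee]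
  have hg0 : 0 < gram g 0 0 := hg.pos _ fun h => by simpa [ee] using congrFun h 0
  have hH1 := congrFun hcol 1
  have hH2 := congrFun hcol 2
  rw [hHeq] at hH1 hH2
  simp [ee, Matrix.vecMul, dotProduct, Fin.sum_univ_four, skewMatrix, hg0.ne'] at hH1 hH2
  rw [← sub_eq_zero, ← hH]
  refine hHeq.trans ?_
  rw [hH1, hH2]
  ext i j
  fin_cases i <;> fin_cases j <;> simp [skewMatrix]

theorem fhat_eq_vecMul (g : V4 → V4 → ℝ) {F : V4 → V4 → ℝ} (hF : IsAltForm F) (x : V4) :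
    fhat g F x = x ᵥ* (gram F * ginv g) := by
  rw [← Matrix.vecMul_vecMul]
  ext m
  simp only [fhat, Matrix.vecMul, dotProduct, gram, Matrix.of_apply]
  exact Finset.sum_congr rfl fun k _ => by rw [apply_eq_sum hF.add_left hF.smul_left x]

theorem exists_fhat_fhat_eq_smul {g F : V4 → V4 → ℝ} (hg : IsInnerProduct g)
    (hF : IsAltForm F) (hcl : IsClosedForm brA47 F) (hco : IsCoclosed brA47 g F) :
    ∃ c : ℝ, ∀ x, fhat g F (fhat g F x) = c • x := by
  obtain ⟨t, ht, h⟩ := exists_skewDual_gram_eq hg hF hcl hco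
  have hsymm : (ginv g)ᵀ = ginv g := by
    rw [ginv, Matrix.transpose_nonsing_inv, hg.gram_transpose]
  refine ⟨t⁻¹ * -pfaffian4 (gram F), fun x => ?_⟩
  have hM : raised g F = t⁻¹ • skewDual (gram F) := by rw [h, inv_smul_smul₀ ht]
  have hsq : gram F * ginv g * (gram F * ginv g) = gram F * raised g F := by
    simp only [raised, hsymm, Matrix.mul_assoc]
  rw [fhat_eq_vecMul g hF, fhat_eq_vecMul g hF, Matrix.vecMul_vecMul, hsq, hM, Matrix.mul_smul,
    mul_skewDual hF.gram_skew, smul_smul, Matrix.vecMul_smul, Matrix.vecMul_one]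

theorem FF0_eq_zero {g F : V4 → V4 → ℝ} (hg : IsInnerProduct g) (hF : IsAltForm F)
    (hcl : IsClosedForm brA47 F) (hco : IsCoclosed brA47 g F) (x y : V4) : FF0 g F x y = 0 := by
  obtain ⟨c, hc⟩ := exists_fhat_fhat_eq_smul hg hF hcl hco
  simp only [FF0, hc, hg.smul_left]
  simp [ee]

/-- `𝒜₄,₇` admits no left-invariant non-Einstein solution to the Einstein--Maxwell equations; in fact every closed and co-closed `F` satisfies `[F∘F]₀ = 0`. -/
theorem stmt13 :
    (∀ g F : V4 → V4 → ℝ, IsInnerProduct g → IsAltForm F →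
      IsEMSolution (brA47) g F → IsEinstein (brA47) g) ∧
    (∀ g F : V4 → V4 → ℝ, IsInnerProduct g → IsAltForm F →
      IsClosedForm brA47 F → IsCoclosed brA47 g F → ∀ x y, FF0 g F x y = 0) := by
  refine ⟨fun g F hg hF ⟨hcl, hco, hEM⟩ x y => ?_, fun g F hg hF => FF0_eq_zero hg hF⟩
  rw [hEM, FF0_eq_zero hg hF hcl hco, neg_zero]
end
end

section
/- Let 𝔤 = 𝒜₄,₈ be the 4-dimensional real Lie algebra with brackets [e₂,e₃] = e₁, [e₂,e₄] = e₂, [e₃,e₄] = −e₃. Then for every inner product g on 𝔤 and every alternating 2-form F on 𝔤 such that (g,F) is a solution of the Einstein–Maxwell equations, the metric g is Einstein. (In fact, the only alternating 2-form F on 𝔤 that is both closed and co-closed with respect to any inner product g is F = 0.) -/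
open scoped BigOperators

noncomputable section

/-- The Lie algebra `𝒜₄,₈`: `[e₂,e₃] = e₁`, `[e₂,e₄] = e₂`, `[e₃,e₄] = −e₃`. -/
def brA48 : V4 → V4 → V4 := fun x y =>
  (x 1 * y 2 - x 2 * y 1) • ee 0
    + (x 1 * y 3 - x 3 * y 1) • ee 1
    + (-(x 2 * y 3 - x 3 * y 2)) • ee 2

open scoped Matrix

theorem bilin_eq_dotProduct_gram (b : V4 →ₗ[ℝ] V4 →ₗ[ℝ] ℝ) (x y : V4) :
    b x y = x ⬝ᵥ gram (fun u v => b u v) *ᵥ y := by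
  have h : gram (fun u v => b u v) = LinearMap.toMatrix₂' ℝ b := by
    ext i j
    simp [gram, ee, LinearMap.toMatrix₂'_apply]
  rw [h, ← Matrix.toLinearMap₂'_apply', Matrix.toLinearMap₂'_toMatrix']

theorem IsInnerProduct.eq_dotProduct_gram {g : V4 → V4 → ℝ} (hg : IsInnerProduct g) (x y : V4) :
    g x y = x ⬝ᵥ gram g *ᵥ y :=
  bilin_eq_dotProduct_gram (LinearMap.mk₂ ℝ g hg.add_left hg.smul_left
    (fun x y z => by simp only [hg.symm x, hg.add_left])
    (fun a x y => by simp only [hg.symm x, hg.smul_left, smul_eq_mul])) x y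

theorem IsAltForm.eq_dotProduct_gram {F : V4 → V4 → ℝ} (hF : IsAltForm F) (x y : V4) :
    F x y = x ⬝ᵥ gram F *ᵥ y :=
  bilin_eq_dotProduct_gram (LinearMap.mk₂ ℝ F hF.add_left hF.smul_left
    (fun x y z => by rw [hF.skew x, hF.add_left, hF.skew y, hF.skew z]; ring)
    (fun a x y => by rw [hF.skew x, hF.smul_left, hF.skew y, smul_eq_mul]; ring)) x y

/-- The form `A ↦ ∑ P i k * P j l * A i j * A k l` is definite when `P` is. -/
theorem Matrix.PosDef.eq_zero_of_sum_eq_zero {n : Type*} [Fintype n]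
    {P A : Matrix n n ℝ} (hP : P.PosDef)
    (h : ∑ i, ∑ j, ∑ k, ∑ l, P i k * P j l * A i j * A k l = 0) : A = 0 := by
  classical
  by_contra hA
  have hne : (fun p : n × n => A p.1 p.2) ≠ 0 := fun h0 =>
    hA (by ext i j; exact congrFun h0 (i, j))
  refine ((hP.kronecker hP).dotProduct_mulVec_pos hne).ne' ?_
  rw [← h]
  simp only [dotProduct, Matrix.mulVec, star_trivial, Fintype.sum_prod_type,
    Matrix.kroneckerMap_apply, Finset.mul_sum]
  refine Finset.sum_congr rfl fun i _ => Finset.sum_congr rfl fun j _ =>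
    Finset.sum_congr rfl fun k _ => Finset.sum_congr rfl fun l _ => ?_
  ring

theorem IsInnerProduct.eq_zero_of_formInner_self {g F : V4 → V4 → ℝ} (hg : IsInnerProduct g)
    (hF : IsAltForm F) (h : formInner g F F = 0) (x y : V4) : F x y = 0 := by
  have hA : gram F = 0 := by
    refine hg.gram_posDef.inv.eq_zero_of_sum_eq_zero ?_
    simpa [formInner, ginv, gram] using h
  simp [hF.eq_dotProduct_gram x y, hA]

theorem IsAltForm.map_zero_left {F : V4 → V4 → ℝ} (hF : IsAltForm F) (y : V4) : F 0 y = 0 := by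
  simpa using hF.smul_left 0 0 y

/-- The centre of `𝒜₄,₈` lies in the kernel of every closed 2-form. -/
theorem IsClosedForm.apply_ee_zero {F : V4 → V4 → ℝ} (hF : IsAltForm F)
    (h : IsClosedForm brA48 F) :
    F (ee 0) (ee 1) = 0 ∧ F (ee 0) (ee 2) = 0 ∧ F (ee 0) (ee 3) = 0 := by
  have h013 := h (ee 0) (ee 1) (ee 3)
  have h023 := h (ee 0) (ee 2) (ee 3)
  have h123 := h (ee 1) (ee 2) (ee 3)
  have hneg : ∀ x y, F (-x) y = -F x y := fun x y => by simpa using hF.smul_left (-1) x y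
  have e : ∀ i j, ee i j = if j = i then (1 : ℝ) else 0 := fun i j => by
    simp [ee, Pi.single_apply]
  simp [cdiff, brA48, e, hneg, hF.map_zero_left] at h013 h023 h123
  have := hF.skew (ee 0) (ee 1)
  have := hF.skew (ee 0) (ee 2)
  have := hF.skew (ee 1) (ee 2)
  refine ⟨?_, ?_, ?_⟩ <;> linarith

theorem eq_zero_of_closed_of_coclosed {g F : V4 → V4 → ℝ} (hg : IsInnerProduct g)
    (hF : IsAltForm F) (hcl : IsClosedForm brA48 F) (hco : IsCoclosed brA48 g F) (x y : V4) :
    F x y = 0 := by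
  obtain ⟨S, ⟨hS, hstar⟩, hScl⟩ := hco
  obtain ⟨f1, f2, f3⟩ := hcl.apply_ee_zero hF
  obtain ⟨s1, s2, s3⟩ := hScl.apply_ee_zero hS
  have hwedge := hstar F hF (ee 0) (ee 1) (ee 2) (ee 3)
  have hvol : vol g (ee 0) (ee 1) (ee 2) (ee 3) ≠ 0 := by
    have hone : (Matrix.of fun i j => ![ee 0, ee 1, ee 2, ee 3] i j) = 1 := by
      ext i j
      fin_cases i <;> simp [ee, Matrix.one_apply, Pi.single_apply, eq_comm]
    rw [vol, hone, Matrix.det_one, mul_one]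
    exact (Real.sqrt_pos.mpr hg.gram_posDef.det_pos).ne'
  simp only [wedge22, f1, f2, f3, s1, s2, s3, zero_mul, mul_zero, sub_zero, add_zero] at hwedge
  exact hg.eq_zero_of_formInner_self hF ((mul_eq_zero.mp hwedge.symm).resolve_right hvol) x y

/-- `𝒜₄,₈` admits no left-invariant non-Einstein solution to the Einstein--Maxwell equations; in fact the only closed and co-closed 2-form is `F = 0`. -/
theorem stmt14 :
    (∀ g F : V4 → V4 → ℝ, IsInnerProduct g → IsAltForm F →
      IsEMSolution (brA48) g F → IsEinstein (brA48) g) ∧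
    (∀ g F : V4 → V4 → ℝ, IsInnerProduct g → IsAltForm F →
      IsClosedForm brA48 F → IsCoclosed brA48 g F → ∀ x y, F x y = 0) := by
  refine ⟨fun g F hg hF hEM x y => ?_, fun g F => eq_zero_of_closed_of_coclosed⟩
  obtain ⟨hcl, hco, hric⟩ := hEM
  have hzero := eq_zero_of_closed_of_coclosed hg hF hcl hco
  have hhat : ∀ v, fhat g F v = 0 := fun v => by
    ext m
    simp [fhat, hzero]
  have hg0 : g 0 y = 0 := by simpa using hg.smul_left 0 0 y
  simp [hric, FF0, hhat, hg0]
end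
end
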